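/- Let N ≥ 1 be an integer, g > 0, and let W₁ be the GUE resolvent built from the rescaled GUE density. Then for every z ∈ ℂ∖ℝ, (g²/N²)·W₁'''(z) + (4g − z²)·W₁'(z) + z·W₁(z) = 2N. -/

import Mathlib

open Nat MeasureTheory

/-- The orthonormal Hermite functions' polynomial part:
`p_n(x) = He_n(x)/√(√(2π)·n!)`, orthonormal for the weight `e^{-x²/2}` on `ℝ`. -/
noncomputable def pOrtho (n : ℕ) (x : ℝ) : ℝ :=
  Polynomial.aeval x (Polynomial.hermite n) /
    Real.sqrt (Real.sqrt (2 * Real.pi) * (n ! : ℝ))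

/-- The (unscaled) GUE eigenvalue density
`ρ_N(x) = √N · e^{-x²/2} · (p_N'(x)p_{N-1}(x) − p_N(x)p_{N-1}'(x))`. -/
noncomputable def gueDensity (N : ℕ) (x : ℝ) : ℝ :=
  Real.sqrt N * Real.exp (-x ^ 2 / 2) *
    (deriv (pOrtho N) x * pOrtho (N - 1) x - pOrtho N x * deriv (pOrtho (N - 1)) x)

/-- The rescaled GUE density `ρ_{(1)}(x) = √(N/g)·ρ_N(√(N/g)·x)`. -/
noncomputable def gueDensityScaled (N : ℕ) (g : ℝ) (x : ℝ) : ℝ :=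
  Real.sqrt ((N : ℝ) / g) * gueDensity N (Real.sqrt ((N : ℝ) / g) * x)

/-- The GUE resolvent `W₁(z) = ∫_ℝ ρ_{(1)}(t)/(z − t) dt` for `z ∈ ℂ∖ℝ`. -/
noncomputable def gueResolvent (N : ℕ) (g : ℝ) (z : ℂ) : ℂ :=
  ∫ t : ℝ, ((gueDensityScaled N g t : ℝ) : ℂ) / (z - (t : ℂ))

open Polynomial

theorem Polynomial.derivative_hermite_succ (n : ℕ) :
    derivative (hermite (n + 1)) = ((n : ℤ[X]) + 1) * hermite n := by
  induction n with
  | zero => simp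
  | succ n ih =>
    rw [hermite_succ (n + 1), derivative_sub, derivative_mul, ih, derivative_X, derivative_mul,
      hermite_succ n]
    simp
    ring

theorem Polynomial.iterate_derivative_hermite_self (n : ℕ) :
    derivative^[n] (hermite n) = (n ! : ℤ[X]) := by
  induction n with
  | zero => simp
  | succ n ih =>
    rw [Function.iterate_succ_apply, derivative_hermite_succ,
      show ((n : ℤ[X]) + 1) = ((n + 1 : ℕ) : ℤ[X]) by push_cast; rfl,
      iterate_derivative_natCast_mul, ih, Nat.factorial_succ]
    push_cast
    ring

/-- The Hermite polynomials with real coefficients. -/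
noncomputable def hermiteReal (n : ℕ) : ℝ[X] := (hermite n).map (Int.castRingHom ℝ)

theorem hermiteReal_succ (n : ℕ) :
    hermiteReal (n + 1) = X * hermiteReal n - derivative (hermiteReal n) := by
  simp [hermiteReal, hermite_succ, derivative_map]

theorem derivative_hermiteReal_succ (n : ℕ) :
    derivative (hermiteReal (n + 1)) = ((n : ℝ[X]) + 1) * hermiteReal n := by
  rw [hermiteReal, derivative_map, derivative_hermite_succ]
  simp [hermiteReal]

theorem derivative_hermiteReal (n : ℕ) :
    derivative (hermiteReal n) = X * hermiteReal n - hermiteReal (n + 1) := by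
  rw [hermiteReal_succ]
  ring

theorem pOrtho_eq (n : ℕ) (x : ℝ) :
    pOrtho n x = (hermiteReal n).eval x / √(√(2 * Real.pi) * (n ! : ℝ)) := by
  rw [pOrtho, hermiteReal, eval_map, aeval_def]
  rfl

theorem deriv_pOrtho (n : ℕ) (x : ℝ) :
    deriv (pOrtho n) x = (derivative (hermiteReal n)).eval x / √(√(2 * Real.pi) * (n ! : ℝ)) := by
  rw [funext (pOrtho_eq n)]
  exact ((hermiteReal n).hasDerivAt x).div_const _ |>.deriv

/-- The product of a polynomial with the Gaussian weight `e^{-x²/2}`. -/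
noncomputable def polyGaussian (Q : ℝ[X]) (x : ℝ) : ℝ := Q.eval x * Real.exp (-x ^ 2 / 2)

/-- The operator on polynomials corresponding to differentiation of `Q(x) e^{-x²/2}`. -/
noncomputable def gaussianDerivative (Q : ℝ[X]) : ℝ[X] := derivative Q - X * Q

theorem hasDerivAt_polyGaussian (Q : ℝ[X]) (x : ℝ) :
    HasDerivAt (polyGaussian Q) (polyGaussian (gaussianDerivative Q) x) x := by
  have h : HasDerivAt (fun x : ℝ => -x ^ 2 / 2) (-x) x := by
    refine ((hasDerivAt_pow 2 x).neg.div_const 2).congr_deriv ?_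
    simp
    ring
  refine ((Q.hasDerivAt x).mul h.exp).congr_deriv ?_
  simp [polyGaussian, gaussianDerivative]
  ring

theorem continuous_polyGaussian (Q : ℝ[X]) : Continuous (polyGaussian Q) :=
  continuous_iff_continuousAt.2 fun x => (hasDerivAt_polyGaussian Q x).continuousAt

theorem integrable_polyGaussian (Q : ℝ[X]) : Integrable (polyGaussian Q) := by
  induction Q using Polynomial.induction_on' with
  | add p q hp hq =>
    refine (hp.add hq).congr (.of_forall fun x => ?_)
    simp [polyGaussian, add_mul]
  | monomial n a =>
    have h := integrable_rpow_mul_exp_neg_mul_sq (b := 1 / 2) (s := n) (by norm_num)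
      (by linarith [n.cast_nonneg (α := ℝ)])
    refine (h.const_mul a).congr (.of_forall fun x => ?_)
    simp only [polyGaussian, eval_monomial, Real.rpow_natCast]
    rw [show -(1 / 2) * x ^ 2 = -x ^ 2 / 2 by ring]
    ring

/-- The integral of a polynomial against the Gaussian weight `e^{-x²/2}`. -/
noncomputable def gaussianIntegral (Q : ℝ[X]) : ℝ := ∫ x, polyGaussian Q x

theorem gaussianIntegral_sub (P Q : ℝ[X]) :
    gaussianIntegral (P - Q) = gaussianIntegral P - gaussianIntegral Q := by
  simp only [gaussianIntegral]
  rw [← integral_sub (integrable_polyGaussian P) (integrable_polyGaussian Q)]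
  simp [polyGaussian, sub_mul]

theorem gaussianIntegral_C_mul (c : ℝ) (Q : ℝ[X]) :
    gaussianIntegral (C c * Q) = c * gaussianIntegral Q := by
  simp only [gaussianIntegral]
  rw [← integral_const_mul]
  simp [polyGaussian, mul_assoc]

theorem gaussianIntegral_one : gaussianIntegral 1 = √(2 * Real.pi) := by
  have h := integral_gaussian (1 / 2)
  rw [show Real.pi / (1 / 2) = 2 * Real.pi by ring] at h
  rw [← h, gaussianIntegral]
  congr 1 with x
  simp only [polyGaussian, eval_one, one_mul]
  congr 1
  ring

theorem gaussianIntegral_gaussianDerivative (Q : ℝ[X]) :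
    gaussianIntegral (gaussianDerivative Q) = 0 :=
  integral_eq_zero_of_hasDerivAt_of_integrable (hasDerivAt_polyGaussian Q)
    (integrable_polyGaussian _) (integrable_polyGaussian Q)

theorem gaussianIntegral_hermiteReal_mul (n : ℕ) (Q : ℝ[X]) :
    gaussianIntegral (hermiteReal n * Q) = gaussianIntegral (derivative^[n] Q) := by
  induction n generalizing Q with
  | zero => simp [hermiteReal]
  | succ n ih =>
    have h := gaussianIntegral_gaussianDerivative (hermiteReal n * Q)
    rw [show gaussianDerivative (hermiteReal n * Q) =
        hermiteReal n * derivative Q - hermiteReal (n + 1) * Q by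
      rw [gaussianDerivative, derivative_mul, hermiteReal_succ]; ring,
      gaussianIntegral_sub, ih, sub_eq_zero] at h
    rw [← h, Function.iterate_succ_apply]

/-- The polynomial part of the GUE density of size `n + 1`. -/
noncomputable def guePoly (n : ℕ) : ℝ[X] :=
  C (√(2 * Real.pi) * (n ! : ℝ))⁻¹ *
    (((n : ℝ[X]) + 1) * (hermiteReal n * hermiteReal n) -
      hermiteReal (n + 1) * derivative (hermiteReal n))

theorem gueDensity_succ (n : ℕ) (x : ℝ) :
    gueDensity (n + 1) x = polyGaussian (guePoly n) x := by
  have hp : 0 < √(2 * Real.pi) := by positivity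
  have hn : (0 : ℝ) < n ! := by positivity
  have h1 : (0 : ℝ) < n + 1 := by positivity
  have hc : √((n : ℝ) + 1) / (√(√(2 * Real.pi) * ((n + 1)! : ℝ)) * √(√(2 * Real.pi) * (n ! : ℝ))) =
      (√(2 * Real.pi) * (n ! : ℝ))⁻¹ := by
    rw [Nat.factorial_succ]
    push_cast
    rw [show √(2 * Real.pi) * (((n : ℝ) + 1) * n !) = (n + 1) * (√(2 * Real.pi) * n !) by ring,
      Real.sqrt_mul h1.le, mul_assoc, Real.mul_self_sqrt (by positivity)]
    field_simp
  simp only [gueDensity, deriv_pOrtho, pOrtho_eq, polyGaussian, guePoly, Nat.add_sub_cancel,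
    derivative_hermiteReal_succ, eval_mul, eval_sub, eval_add, eval_natCast, eval_one, eval_C,
    ← hc]
  push_cast
  ring

theorem gaussianIntegral_guePoly (n : ℕ) : gaussianIntegral (guePoly n) = n + 1 := by
  have h0 : derivative^[n] (hermiteReal n) = C (n ! : ℝ) := by
    rw [hermiteReal, iterate_derivative_map, iterate_derivative_hermite_self]
    simp
  have h1 : derivative^[n + 1] (derivative (hermiteReal n)) = 0 := by
    rw [← Function.iterate_succ_apply, Function.iterate_succ_apply',
      Function.iterate_succ_apply', h0]
    simp
  rw [guePoly, gaussianIntegral_C_mul, gaussianIntegral_sub,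
    show ((n : ℝ[X]) + 1) = C ((n : ℝ) + 1) by simp, gaussianIntegral_C_mul,
    gaussianIntegral_hermiteReal_mul, gaussianIntegral_hermiteReal_mul, h0, h1,
    ← mul_one (C (n ! : ℝ)), gaussianIntegral_C_mul, gaussianIntegral_one,
    ← mul_zero (C 0), gaussianIntegral_C_mul]
  have hp : √(2 * Real.pi) ≠ 0 := by positivity
  field_simp
  ring

theorem gaussianDerivative_guePoly (n : ℕ) :
    gaussianDerivative (guePoly n) =
      C (-(√(2 * Real.pi) * (n ! : ℝ))⁻¹) * (hermiteReal (n + 1) * hermiteReal n) := by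
  simp only [gaussianDerivative, guePoly, derivative_mul, derivative_C, derivative_sub,
    derivative_add, derivative_natCast, derivative_one, derivative_X, derivative_hermiteReal_succ,
    derivative_hermiteReal n, C_neg]
  ring

theorem guePoly_ode (n : ℕ) :
    gaussianDerivative (gaussianDerivative (gaussianDerivative (guePoly n))) +
      C (4 * ((n : ℝ) + 1)) * gaussianDerivative (guePoly n) -
      X * (X * gaussianDerivative (guePoly n)) + X * guePoly n = 0 := by
  rw [gaussianDerivative_guePoly]
  simp only [gaussianDerivative, guePoly, derivative_mul, derivative_C, derivative_sub,
    derivative_add, derivative_natCast, derivative_one, derivative_X, derivative_hermiteReal_succ,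
    derivative_hermiteReal n, C_neg, C_mul, C_add, C_1, map_natCast, C_ofNat, derivative_neg,
    derivative_zero]
  ring

/-- The Cauchy transform of `Q(x) e^{-x²/2}`. -/
noncomputable def gaussianCauchy (Q : ℝ[X]) (z : ℂ) : ℂ :=
  ∫ t : ℝ, (polyGaussian Q t : ℂ) / (z - t)

theorem Complex.abs_im_le_norm_sub_ofReal (z : ℂ) (t : ℝ) : |z.im| ≤ ‖z - t‖ := by
  simpa using Complex.abs_im_le_norm (z - t)

theorem Complex.sub_ofReal_ne_zero {z : ℂ} (hz : z.im ≠ 0) (t : ℝ) : z - t ≠ 0 :=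
  norm_pos_iff.1 ((abs_pos.2 hz).trans_le (Complex.abs_im_le_norm_sub_ofReal z t))

theorem integrable_polyGaussian_div_pow (Q : ℝ[X]) {z : ℂ} (hz : z.im ≠ 0) (k : ℕ) :
    Integrable fun t : ℝ => (polyGaussian Q t : ℂ) / (z - t) ^ k := by
  have hc : Continuous fun t : ℝ => (polyGaussian Q t : ℂ) / (z - t) ^ k :=
    (Complex.continuous_ofReal.comp (continuous_polyGaussian Q)).div
      (by fun_prop) fun t => pow_ne_zero _ (Complex.sub_ofReal_ne_zero hz t)
  refine ((integrable_polyGaussian Q).norm.div_const (|z.im| ^ k)).mono'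
    hc.aestronglyMeasurable (.of_forall fun t => ?_)
  rw [norm_div, norm_pow, Complex.norm_real]
  have := abs_pos.2 hz
  gcongr
  exact Complex.abs_im_le_norm_sub_ofReal z t

theorem integrable_neg_polyGaussian_div_sq (Q : ℝ[X]) {z : ℂ} (hz : z.im ≠ 0) :
    Integrable fun t : ℝ => -(polyGaussian Q t : ℂ) / (z - t) ^ 2 := by
  simpa only [neg_div] using (integrable_polyGaussian_div_pow Q hz 2).fun_neg

theorem integrable_polyGaussian_div (Q : ℝ[X]) {z : ℂ} (hz : z.im ≠ 0) :
    Integrable fun t : ℝ => (polyGaussian Q t : ℂ) / (z - t) := by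
  simpa using integrable_polyGaussian_div_pow Q hz 1

theorem gaussianCauchy_add (P Q : ℝ[X]) {z : ℂ} (hz : z.im ≠ 0) :
    gaussianCauchy (P + Q) z = gaussianCauchy P z + gaussianCauchy Q z := by
  simp only [gaussianCauchy]
  rw [← integral_add (integrable_polyGaussian_div P hz) (integrable_polyGaussian_div Q hz)]
  simp [polyGaussian, add_mul, add_div]

theorem gaussianCauchy_C_mul (c : ℝ) (Q : ℝ[X]) (z : ℂ) :
    gaussianCauchy (C c * Q) z = c * gaussianCauchy Q z := by
  simp only [gaussianCauchy]
  rw [← integral_const_mul]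
  simp [polyGaussian, mul_assoc, mul_div_assoc]

theorem gaussianCauchy_sub (P Q : ℝ[X]) {z : ℂ} (hz : z.im ≠ 0) :
    gaussianCauchy (P - Q) z = gaussianCauchy P z - gaussianCauchy Q z := by
  rw [eq_sub_iff_add_eq, ← gaussianCauchy_add _ _ hz, sub_add_cancel]

theorem gaussianCauchy_X_mul (Q : ℝ[X]) {z : ℂ} (hz : z.im ≠ 0) :
    gaussianCauchy (X * Q) z = z * gaussianCauchy Q z - gaussianIntegral Q := by
  have hi : Integrable fun t : ℝ => (polyGaussian Q t : ℂ) := (integrable_polyGaussian Q).ofReal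
  simp only [gaussianCauchy, gaussianIntegral]
  rw [← integral_complex_ofReal, ← integral_const_mul,
    ← integral_sub ((integrable_polyGaussian_div Q hz).const_mul z) hi]
  congr 1 with t
  have := Complex.sub_ofReal_ne_zero hz t
  simp only [polyGaussian, eval_mul, eval_X]
  push_cast
  field_simp
  ring

theorem integral_polyGaussian_div_sq (Q : ℝ[X]) {z : ℂ} (hz : z.im ≠ 0) :
    ∫ t : ℝ, -(polyGaussian Q t : ℂ) / (z - t) ^ 2 = gaussianCauchy (gaussianDerivative Q) z := by
  have h := integral_eq_zero_of_hasDerivAt_of_integrable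
    (f := fun t : ℝ => (polyGaussian Q t : ℂ) / (z - t))
    (f' := fun t : ℝ => (polyGaussian (gaussianDerivative Q) t : ℂ) / (z - t) -
      -(polyGaussian Q t : ℂ) / (z - t) ^ 2) (fun t => ?_)
    ((integrable_polyGaussian_div _ hz).sub (integrable_neg_polyGaussian_div_sq Q hz))
    (integrable_polyGaussian_div Q hz)
  · rw [integral_sub (integrable_polyGaussian_div _ hz) (integrable_neg_polyGaussian_div_sq Q hz), sub_eq_zero] at h
    exact h.symm
  · have hne := Complex.sub_ofReal_ne_zero hz t
    refine ((hasDerivAt_polyGaussian Q t).ofReal_comp.div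
      ((hasDerivAt_id t).ofReal_comp.const_sub z) hne).congr_deriv ?_
    simp only [id]
    field_simp
    push_cast
    ring

theorem hasDerivAt_gaussianCauchy (Q : ℝ[X]) {z : ℂ} (hz : z.im ≠ 0) :
    HasDerivAt (gaussianCauchy Q) (gaussianCauchy (gaussianDerivative Q) z) z := by
  have him : 0 < |z.im| := abs_pos.2 hz
  have hball : ∀ w ∈ Metric.ball z (|z.im| / 2), |z.im| / 2 ≤ |w.im| := by
    intro w hw
    have h1 : |w.im - z.im| ≤ ‖w - z‖ := by simpa using Complex.abs_im_le_norm (w - z)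
    have h2 := mem_ball_iff_norm.1 hw
    have h3 := abs_sub_abs_le_abs_sub z.im w.im
    rw [abs_sub_comm] at h3
    linarith
  rw [← integral_polyGaussian_div_sq Q hz]
  refine (hasDerivAt_integral_of_dominated_loc_of_deriv_le
    (bound := fun t => ‖polyGaussian Q t‖ / (|z.im| / 2) ^ 2)
    (F := fun w (t : ℝ) => (polyGaussian Q t : ℂ) / (w - t))
    (F' := fun w (t : ℝ) => -(polyGaussian Q t : ℂ) / (w - t) ^ 2)
    (Metric.ball_mem_nhds z (half_pos him)) ?_ (integrable_polyGaussian_div Q hz) ?_ ?_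
    ((integrable_polyGaussian Q).norm.div_const _) ?_).2
  · filter_upwards [Metric.ball_mem_nhds z (half_pos him)] with w hw
    exact (integrable_polyGaussian_div Q
      (abs_pos.1 ((half_pos him).trans_le (hball w hw)))).aestronglyMeasurable
  · exact (integrable_neg_polyGaussian_div_sq Q hz).aestronglyMeasurable
  · refine .of_forall fun t w hw => ?_
    rw [norm_div, norm_pow, norm_neg, Complex.norm_real]
    gcongr
    exact (hball w hw).trans (Complex.abs_im_le_norm_sub_ofReal w t)
  · refine .of_forall fun t w hw => ?_
    have hne := Complex.sub_ofReal_ne_zero (abs_pos.1 ((half_pos him).trans_le (hball w hw))) t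
    refine ((hasDerivAt_const w (polyGaussian Q t : ℂ)).div
      ((hasDerivAt_id w).sub_const (t : ℂ)) hne).congr_deriv ?_
    simp

theorem gueResolvent_succ_eq (n : ℕ) {g : ℝ} (hg : 0 < g) (z : ℂ) :
    gueResolvent (n + 1) g z =
      (√(((n + 1 : ℕ) : ℝ) / g) : ℂ) *
        gaussianCauchy (guePoly n) ((√(((n + 1 : ℕ) : ℝ) / g) : ℂ) * z) := by
  have ha : 0 < √(((n + 1 : ℕ) : ℝ) / g) := by positivity
  simp only [gueResolvent, gueDensityScaled]
  generalize √(((n + 1 : ℕ) : ℝ) / g) = a at ha ⊢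
  have hac : (a : ℂ) ≠ 0 := mod_cast ha.ne'
  have h := Measure.integral_comp_mul_left
    (fun t : ℝ => (a : ℂ) ^ 2 * ((polyGaussian (guePoly n) t : ℂ) / (a * z - t))) a
  rw [abs_of_pos (inv_pos.2 ha), Complex.real_smul] at h
  rw [gaussianCauchy]
  calc _ = ∫ t : ℝ, (a : ℂ) ^ 2 * ((polyGaussian (guePoly n) (a * t) : ℂ) /
        (a * z - (a * t : ℝ))) := by
        congr 1 with t
        rw [gueDensity_succ]
        push_cast
        rw [← mul_sub]
        field_simp
    _ = _ := by
        rw [h, integral_const_mul]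
        push_cast
        field_simp

theorem gaussianCauchy_guePoly_ode (n : ℕ) {z : ℂ} (hz : z.im ≠ 0) :
    gaussianCauchy (gaussianDerivative (gaussianDerivative (gaussianDerivative (guePoly n)))) z +
      (4 * ((n : ℂ) + 1) - z ^ 2) * gaussianCauchy (gaussianDerivative (guePoly n)) z +
      z * gaussianCauchy (guePoly n) z = 2 * ((n : ℂ) + 1) := by
  have h0 : gaussianCauchy 0 z = 0 := by simp [gaussianCauchy, polyGaussian]
  have hX : gaussianIntegral (X * gaussianDerivative (guePoly n)) = -(n + 1) := by
    rw [show X * gaussianDerivative (guePoly n) =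
        gaussianDerivative (X * guePoly n) - guePoly n by
      simp only [gaussianDerivative, derivative_mul, derivative_X]; ring,
      gaussianIntegral_sub, gaussianIntegral_gaussianDerivative, gaussianIntegral_guePoly,
      zero_sub]
  have h := h0
  rw [← guePoly_ode n, gaussianCauchy_add _ _ hz, gaussianCauchy_sub _ _ hz,
    gaussianCauchy_add _ _ hz, gaussianCauchy_C_mul, gaussianCauchy_X_mul _ hz,
    gaussianCauchy_X_mul _ hz, gaussianCauchy_X_mul _ hz, hX, gaussianIntegral_guePoly,
    gaussianIntegral_gaussianDerivative] at h
  push_cast at h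
  linear_combination h

theorem iteratedDeriv_gaussianCauchy_comp_mul (Q : ℝ[X]) {a : ℝ} (ha : a ≠ 0) (k : ℕ) {z : ℂ}
    (hz : z.im ≠ 0) :
    iteratedDeriv k (fun w => (a : ℂ) * gaussianCauchy Q (a * w)) z =
      (a : ℂ) ^ (k + 1) * gaussianCauchy (gaussianDerivative^[k] Q) (a * z) := by
  induction k generalizing z with
  | zero => simp
  | succ k ih =>
    have haz : ((a : ℂ) * z).im ≠ 0 := by simpa using ⟨ha, hz⟩
    have hev : iteratedDeriv k (fun w => (a : ℂ) * gaussianCauchy Q (a * w)) =ᶠ[nhds z]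
        fun w => (a : ℂ) ^ (k + 1) * gaussianCauchy (gaussianDerivative^[k] Q) (a * w) := by
      filter_upwards [(isOpen_ne.preimage Complex.continuous_im).mem_nhds hz] with w hw
      exact ih hw
    rw [iteratedDeriv_succ, hev.deriv_eq, Function.iterate_succ_apply']
    have h := ((hasDerivAt_gaussianCauchy (gaussianDerivative^[k] Q) haz).comp z
      ((hasDerivAt_id z).const_mul (a : ℂ))).const_mul ((a : ℂ) ^ (k + 1))
    refine h.deriv.trans ?_
    ring

/-- The GUE resolvent satisfies the third order inhomogeneous ODE
`(g²/N²)W₁''' + (4g − z²)W₁' + z·W₁ = 2N` off the real axis. -/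
theorem gueResolvent_ode (N : ℕ) (hN : 1 ≤ N) (g : ℝ) (hg : 0 < g)
    (z : ℂ) (hz : z.im ≠ 0) :
    ((g : ℂ) ^ 2 / (N : ℂ) ^ 2) * iteratedDeriv 3 (gueResolvent N g) z +
        (4 * (g : ℂ) - z ^ 2) * deriv (gueResolvent N g) z +
        z * gueResolvent N g z = 2 * (N : ℂ) := by
  obtain ⟨n, rfl⟩ := Nat.exists_eq_add_of_le' hN
  rw [← iteratedDeriv_one, funext (gueResolvent_succ_eq n hg)]
  have ha : 0 < √(((n + 1 : ℕ) : ℝ) / g) := by positivity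
  have hsq : (√(((n + 1 : ℕ) : ℝ) / g) : ℂ) ^ 2 * g = n + 1 := by
    have h : √(((n + 1 : ℕ) : ℝ) / g) ^ 2 * g = n + 1 := by
      rw [Real.sq_sqrt (by positivity)]
      push_cast
      field_simp
    exact_mod_cast h
  generalize √(((n + 1 : ℕ) : ℝ) / g) = a at ha hsq ⊢
  have hode := gaussianCauchy_guePoly_ode n (z := a * z) (by simpa using ⟨ha.ne', hz⟩)
  rw [iteratedDeriv_gaussianCauchy_comp_mul _ ha.ne' 3 hz,
    iteratedDeriv_gaussianCauchy_comp_mul _ ha.ne' 1 hz]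
  simp only [Function.iterate_succ_apply, Function.iterate_zero, id]
  push_cast
  have hac : (a : ℂ) ≠ 0 := mod_cast ha.ne'
  have hgc : (g : ℂ) ≠ 0 := mod_cast hg.ne'
  have hq : (g : ℂ) ^ 2 / ((n : ℂ) + 1) ^ 2 = 1 / (a : ℂ) ^ 4 := by
    rw [← hsq]
    field_simp
  have hcancel : 1 / (a : ℂ) ^ 4 * (a : ℂ) ^ (3 + 1) = 1 := by field_simp
  rw [hq, ← mul_assoc, hcancel]
  linear_combination hode + 4 * gaussianCauchy (gaussianDerivative (guePoly n)) (a * z) * hsq
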